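/- Let φ : C_κ → ℝ be convex and monotone with φ(0) = 0 and continuous from above, i.e. φ(f_n) ↓ φ(f) whenever (f_n) ⊂ C_κ decreases pointwise to f ∈ C_κ. Then for every r ≥ 0 the set M_r := {μ ∈ ca_κ⁺ : φ*(μ) ≤ φ(2r/κ) − 2φ(−r/κ)} is convex and compact in the topology σ(ca_κ⁺, C_κ), and φ(f) = max_{μ ∈ M_r} ( ∫_X f dμ − φ*(μ) ) for all f ∈ B_{C_κ}(r), the maximum being attained. -/

import Mathlib

open Filter MeasureTheory Topology
open scoped ENNReal Topology

noncomputable section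

def ecoe {X : Type*} (f : X → ℝ) : X → EReal := fun x => (f x : EReal)

variable {X : Type*} [MetricSpace X]

/-- membership in `C_κ` -/
def MemCk (κ : X → ℝ) (f : X → ℝ) : Prop :=
  Continuous f ∧ ∃ r : ℝ, ∀ x, |f x| * κ x ≤ r

/-- `‖f‖_κ ≤ r` -/
def CkBound (κ : X → ℝ) (r : ℝ) (f : X → ℝ) : Prop := ∀ x, |f x| * κ x ≤ r

/-- extended `κ`-norm of an `EReal`-valued function -/
def eknorm (κ : X → ℝ) (f : X → EReal) : ℝ≥0∞ :=
  ⨆ x, (f x).abs * ENNReal.ofReal (κ x)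

/-- positive part of an `EReal`-valued function -/
def epos {X : Type*} (f : X → EReal) : X → EReal := fun x => max (f x) 0

/-- membership in `U_κ` -/
def MemUk (κ : X → ℝ) (f : X → EReal) : Prop :=
  UpperSemicontinuous f ∧ (∀ x, f x < ⊤) ∧
    ∃ r : ℝ, ∀ x, max (f x) 0 * (κ x : EReal) ≤ (r : EReal)

/-- `Γ`-limsup of a sequence of functions -/
def gammaLimsup (f : ℕ → X → EReal) (x : X) : EReal :=
  ⨆ (u : ℕ → X) (_ : Tendsto u atTop (𝓝 x)),
    Filter.limsup (fun n => f n (u n)) atTop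

/-- `g = Γ-lim f_n` -/
def IsGammaLim (f : ℕ → X → EReal) (g : X → EReal) : Prop :=
  ∀ x : X,
    (∀ u : ℕ → X, Tendsto u atTop (𝓝 x) →
      Filter.limsup (fun n => f n (u n)) atTop ≤ g x) ∧
    (∃ u : ℕ → X, Tendsto u atTop (𝓝 x) ∧
      Tendsto (fun n => f n (u n)) atTop (𝓝 (g x)))

/-- `Γ`-limsup as `h ↓ 0` -/
def gammaLimsupZero (F : ℝ → X → EReal) (x : X) : EReal :=
  ⨆ (h : ℕ → ℝ) (_ : ∀ n, 0 < h n) (_ : Tendsto h atTop (𝓝 (0:ℝ))),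
    gammaLimsup (fun n => F (h n)) x

/-- `Γ`-limsup as `s → t`, `s ≥ 0` -/
def gammaLimsupAt (F : ℝ → X → EReal) (t : ℝ) (x : X) : EReal :=
  ⨆ (s : ℕ → ℝ) (_ : ∀ n, 0 ≤ s n) (_ : Tendsto s atTop (𝓝 t)),
    gammaLimsup (fun n => F (s n)) x

/-- Assumption S on a family of operators on `U_κ` -/
structure AssumptionS (κ : X → ℝ) (S : ℝ → (X → EReal) → (X → EReal)) : Prop where
  monotone : ∀ t, 0 ≤ t → ∀ f g, MemUk κ f → MemUk κ g →
    (∀ x, f x ≤ g x) → ∀ x, S t f x ≤ S t g x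
  convex : ∀ t, 0 ≤ t → ∀ f g, MemUk κ f → MemUk κ g → ∀ lam : ℝ, 0 ≤ lam → lam ≤ 1 →
    ∀ x, S t (fun y => (lam : EReal) * f y + ((1 - lam : ℝ) : EReal) * g y) x
      ≤ (lam : EReal) * S t f x + ((1 - lam : ℝ) : EReal) * S t g x
  zero : ∀ t, 0 ≤ t → ∀ x, S t (fun _ => (0 : EReal)) x = 0
  maps : ∀ t, 0 ≤ t → ∀ f, MemUk κ f → MemUk κ (S t f)
  contAbove : ∀ t, 0 ≤ t → ∀ (f : ℕ → X → EReal) (g : X → EReal),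
    (∀ n, MemUk κ (f n)) → MemUk κ g →
    (∀ x, Antitone fun n => f n x) → (∀ x, (⨅ n, f n x) = g x) →
    ∀ x, (⨅ n, S t (f n) x) = S t g x
  gammaUsc : ∀ t, 0 ≤ t → ∀ f, MemUk κ f →
    ∀ x, gammaLimsupAt (fun s => S s f) t x ≤ S t f x
  idZero : ∀ f, MemUk κ f → S 0 f = f
  bounded : ∀ r t : ℝ, 0 ≤ r → 0 ≤ t → ∃ C : ℝ≥0∞, C ≠ ⊤ ∧
    ∀ s, 0 ≤ s → s ≤ t → ∀ f : X → ℝ, MemCk κ f → CkBound κ r f →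
      eknorm κ (S s (ecoe f)) ≤ C

/-- an `EReal`-valued function which belongs to `C_κ` -/
def IsCk (κ : X → ℝ) (F : X → EReal) : Prop :=
  ∃ g : X → ℝ, MemCk κ g ∧ ∀ x, F x = (g x : EReal)

/-- the upper Lipschitz set `L^S_+` -/
def UpperLip (κ : X → ℝ) (S : ℝ → (X → EReal) → (X → EReal)) (f : X → ℝ) : Prop :=
  MemCk κ f ∧
  (∀ t, 0 ≤ t → IsCk κ (S t (ecoe f))) ∧
  (∀ s t, 0 ≤ s → 0 ≤ t → S (s + t) (ecoe f) = S s (S t (ecoe f))) ∧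
  ∃ h₀ > (0:ℝ), ∃ c ≥ (0:ℝ), ∀ h, 0 ≤ h → h ≤ h₀ → ∀ x,
    max (S h (ecoe f) x - (f x : EReal)) 0 * (κ x : EReal) ≤ ((c * h : ℝ) : EReal)

/-- the (two-sided) Lipschitz set `L^S` -/
def LipSet (κ : X → ℝ) (S : ℝ → (X → EReal) → (X → EReal)) (f : X → ℝ) : Prop :=
  MemCk κ f ∧
  (∀ t, 0 ≤ t → IsCk κ (S t (ecoe f))) ∧
  (∀ s t, 0 ≤ s → 0 ≤ t → S (s + t) (ecoe f) = S s (S t (ecoe f))) ∧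
  ∃ h₀ > (0:ℝ), ∃ c ≥ (0:ℝ), ∀ h, 0 ≤ h → h ≤ h₀ → ∀ x,
    (S h (ecoe f) x - (f x : EReal)).abs * ENNReal.ofReal (κ x) ≤ ENNReal.ofReal (c * h)

/-- difference quotient `(S(h)f - f)/h` -/
def diffQuot (S : ℝ → (X → EReal) → (X → EReal)) (f : X → ℝ) (h : ℝ) : X → EReal :=
  fun x => ((h⁻¹ : ℝ) : EReal) * (S h (ecoe f) x - (f x : EReal))

/-- the upper `Γ`-generator `A_Γ⁺` -/
def uppGen (S : ℝ → (X → EReal) → (X → EReal)) (f : X → ℝ) : X → EReal :=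
  fun x => gammaLimsupZero (fun h => diffQuot S f h) x

/-- `g = A_Γ f`, i.e. the `Γ`-limit of the difference quotients exists and equals `g` -/
def IsGammaDeriv (S : ℝ → (X → EReal) → (X → EReal)) (f : X → ℝ) (g : X → EReal) : Prop :=
  ∀ h : ℕ → ℝ, (∀ n, 0 < h n) → Tendsto h atTop (𝓝 (0:ℝ)) →
    IsGammaLim (fun n => diffQuot S f (h n)) g

/-- `g = Af` in the mixed topology -/
def MixedDeriv (κ : X → ℝ) (S : ℝ → (X → EReal) → (X → EReal)) (f : X → ℝ) (g : X → ℝ) : Prop :=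
  (∃ h₀ > (0:ℝ), ∃ r : ℝ, ∀ h, 0 < h → h ≤ h₀ → ∀ x,
      |h⁻¹ * ((S h (ecoe f) x).toReal - f x)| * κ x ≤ r) ∧
  ∀ K : Set X, IsCompact K → ∀ ε > (0:ℝ), ∃ h₀ > (0:ℝ), ∀ h, 0 < h → h ≤ h₀ → ∀ x ∈ K,
    |h⁻¹ * ((S h (ecoe f) x).toReal - f x) - g x| ≤ ε

/-- upper `ε`-parallel function -/
def parallel (κ : X → ℝ) (f : X → EReal) (ε : ℝ) : X → EReal :=
  fun x => (((κ x)⁻¹ : ℝ) : EReal) *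
    ((⨆ y ∈ Metric.closedBall x ε, max (f y * (κ y : EReal)) (((-ε⁻¹ : ℝ)) : EReal)) + (ε : EReal))

/-- upper semicontinuous envelope of the upper `ε`-parallel function -/
def parallelEnv (κ : X → ℝ) (f : X → EReal) (ε : ℝ) : X → EReal :=
  fun x => ⨅ (δ : ℝ) (_ : 0 < δ), ⨆ y ∈ Metric.closedBall x δ, parallel κ f ε y

end

noncomputable section

/-- truncation of an extended real to `ℝ≥0∞` -/
def erealToENNReal (x : EReal) : ℝ≥0∞ := if x = ⊤ then ⊤ else ENNReal.ofReal x.toReal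

/-- Lebesgue integral of an `EReal`-valued function on `(a,b]`, with values in `[-∞,∞]` -/
def eIntegral (a b : ℝ) (F : ℝ → EReal) : EReal :=
  ((∫⁻ s in Set.Ioc a b, erealToENNReal (max (F s) 0)) : ℝ≥0∞) -
  ((∫⁻ s in Set.Ioc a b, erealToENNReal (max (-F s) 0)) : ℝ≥0∞)

/-- convolution `f * μ` of an `EReal`-valued function with a measure -/
def econv {X : Type*} [NormedAddCommGroup X] [MeasurableSpace X]
    (μ : Measure X) (f : X → EReal) (x : X) : EReal :=
  ((∫⁻ y, erealToENNReal (max (f (x - y)) 0) ∂μ : ℝ≥0∞) : EReal) -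
  ((∫⁻ y, erealToENNReal (max (-f (x - y)) 0) ∂μ : ℝ≥0∞) : EReal)

/-- conjugate functional `φ*` -/
def dualConj {X : Type*} [MetricSpace X] [MeasurableSpace X]
    (κ : X → ℝ) (φ : (X → ℝ) → ℝ) (μ : Measure X) : EReal :=
  ⨆ f : {g : X → ℝ // MemCk κ g}, (((∫ x, f.1 x ∂μ) : ℝ) : EReal) - ((φ f.1 : ℝ) : EReal)

/-- the topology `σ(ca_κ⁺, C_κ)` on measures -/
def weakTopo {X : Type*} [MetricSpace X] [MeasurableSpace X] (κ : X → ℝ) :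
    TopologicalSpace (Measure X) :=
  TopologicalSpace.induced
    (fun μ => fun f : {g : X → ℝ // MemCk κ g} => ∫ x, f.1 x ∂μ) Pi.topologicalSpace

/-- `φ₁`, the extension of `φ` from `C_κ` to `U_κ` -/
def extUk {X : Type*} [MetricSpace X] (κ : X → ℝ) (φ : (X → ℝ) → ℝ) (f : X → EReal) : EReal :=
  ⨅ g : {g : X → ℝ // MemCk κ g ∧ ∀ x, f x ≤ (g x : EReal)}, ((φ g.1 : ℝ) : EReal)

end

open scoped NNReal


open BoundedContinuousFunction in
/-- Pullback of a functional on bounded functions to a compact space. -/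
noncomputable def pullbackFunctional {X Y : Type*} [TopologicalSpace X] [TopologicalSpace Y] [CompactSpace Y]
    (Λ : BoundedContinuousFunction X ℝ →ₗ[ℝ] ℝ) (ι : C(X, Y)) :
    CompactlySupportedContinuousMap Y ℝ →ₗ[ℝ] ℝ where
  toFun g := Λ ((mkOfCompact g.toContinuousMap).compContinuous ι)
  map_add' a b := by
    rw [← map_add]; rfl
  map_smul' c a := by
    rw [← map_smul]; rfl

open BoundedContinuousFunction in
theorem daniell_pull {X Y : Type*} [TopologicalSpace X] [PolishSpace X] [MeasurableSpace X]
    [BorelSpace X] [TopologicalSpace Y] [CompactSpace Y] [TopologicalSpace.MetrizableSpace Y]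
    [MeasurableSpace Y] [BorelSpace Y]
    (Λ : BoundedContinuousFunction X ℝ →ₗ[ℝ] ℝ)
    (hpos : ∀ f : BoundedContinuousFunction X ℝ, (∀ x, 0 ≤ f x) → 0 ≤ Λ f)
    (hcont : ∀ fn : ℕ → BoundedContinuousFunction X ℝ, (∀ x, Antitone fun n => fn n x) →
      (∀ x, Tendsto (fun n => fn n x) atTop (𝓝 0)) → Tendsto (fun n => Λ (fn n)) atTop (𝓝 0))
    (ι : C(X, Y)) (hι : Function.Injective ι) :
    ∃ ν : Measure X, IsFiniteMeasure ν ∧ ∀ g : C(Y, ℝ), ∫ x, g (ι x) ∂ν =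
      Λ ((mkOfCompact g).compContinuous ι) := by
  let _ := TopologicalSpace.metrizableSpaceMetric Y
  let Λ' := PositiveLinearMap.mk₀ (pullbackFunctional Λ ι) (fun g hg => hpos _ (fun x => CompactlySupportedContinuousMap.le_def.1 hg (ι x)))
  let ρ := RealRMK.rieszMeasure Λ'
  have hρ : ∀ g : C(Y, ℝ), ∫ y, g y ∂ρ = Λ ((mkOfCompact g).compContinuous ι) := fun g =>
    RealRMK.integral_rieszMeasure Λ' (CompactlySupportedContinuousMap.continuousMapEquiv g)
  have hfin : IsFiniteMeasure ρ := inferInstance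
  have hemb : MeasurableEmbedding ι := ι.continuous.measurableEmbedding hι
  have hK : ∀ K : Set Y, K ⊆ (Set.range ι)ᶜ → IsCompact K → ρ K = 0 := by
    intro K hKr hKc
    rcases K.eq_empty_or_nonempty with rfl | hne
    · simp
    let g : ℕ → C(Y, ℝ) := fun n =>
      ⟨fun y => max 0 (1 - n * Metric.infDist y K), by fun_prop⟩
    have h1 : Tendsto (fun n => Λ ((mkOfCompact (g n)).compContinuous ι)) atTop (𝓝 0) := by
      apply hcont
      · intro x n m hnm
        simp only [g, compContinuous_apply, mkOfCompact_apply, ContinuousMap.coe_mk]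
        have := Metric.infDist_nonneg (x := ι x) (s := K)
        gcongr
      · intro x
        have hp : 0 < Metric.infDist (ι x) K := by
          rw [← hKc.isClosed.notMem_iff_infDist_pos hne]
          exact fun h => hKr h ⟨x, rfl⟩
        obtain ⟨N, hN⟩ := exists_nat_gt (1 / Metric.infDist (ι x) K)
        apply tendsto_const_nhds.congr'
        filter_upwards [eventually_ge_atTop N] with n hn
        simp only [g, compContinuous_apply, mkOfCompact_apply, ContinuousMap.coe_mk]
        symm; apply max_eq_left
        have : (N:ℝ) ≤ n := by exact_mod_cast hn
        rw [div_lt_iff₀ hp] at hN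
        nlinarith
    have h2 : ∀ n, ρ.real K ≤ Λ ((mkOfCompact (g n)).compContinuous ι) := by
      intro n
      rw [← hρ, ← integral_indicator_one hKc.measurableSet]
      apply integral_mono
      · exact (integrable_const (1:ℝ)).indicator hKc.measurableSet
      · exact (g n).continuous.integrable_of_hasCompactSupport (HasCompactSupport.of_compactSpace _)
      · intro y
        by_cases hy : y ∈ K
        · simp [hy, g, Metric.infDist_zero_of_mem hy]
        · simp [hy, g]
    have h3 : ρ.real K ≤ 0 := ge_of_tendsto' h1 h2
    have h4 : ρ.real K = 0 := le_antisymm h3 measureReal_nonneg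
    rwa [measureReal_eq_zero_iff] at h4
  have h0 : ρ (Set.range ι)ᶜ = 0 := by
    rw [hemb.measurableSet_range.compl.measure_eq_iSup_isCompact_of_ne_top (measure_ne_top _ _)]
    simp only [ENNReal.iSup_eq_zero]
    exact hK
  refine ⟨ρ.comap ι, ?_, ?_⟩
  · constructor
    rw [hemb.comap_apply]
    exact measure_lt_top _ _
  · intro g
    rw [← hρ, ← hemb.integral_map, hemb.map_comap]
    rw [Measure.restrict_eq_self_of_ae_mem]
    exact h0

open BoundedContinuousFunction in
theorem daniell_bcf {X : Type*} [TopologicalSpace X] [PolishSpace X] [MeasurableSpace X]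
    [BorelSpace X] 
    (Λ : BoundedContinuousFunction X ℝ →ₗ[ℝ] ℝ)
    (hpos : ∀ f : BoundedContinuousFunction X ℝ, (∀ x, 0 ≤ f x) → 0 ≤ Λ f)
    (hcont : ∀ fn : ℕ → BoundedContinuousFunction X ℝ, (∀ x, Antitone fun n => fn n x) →
      (∀ x, Tendsto (fun n => fn n x) atTop (𝓝 0)) → Tendsto (fun n => Λ (fn n)) atTop (𝓝 0)) :
    ∃ ν : Measure X, IsFiniteMeasure ν ∧ ∀ g : BoundedContinuousFunction X ℝ, ∫ x, g x ∂ν = Λ g := by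
  let _ := TopologicalSpace.upgradeIsCompletelyMetrizable X
  obtain ⟨F, hF⟩ := Metric.PiNatEmbed.exists_embedding_to_hilbert_cube (X := X)
  let ι : C(X, ℕ → unitInterval) := ⟨F, hF.continuous⟩
  obtain ⟨ν, hν, hνi⟩ := daniell_pull Λ hpos hcont ι hF.injective
  refine ⟨ν, hν, fun h => ?_⟩
  let M := ‖h‖
  let ι' : C(X, (ℕ → unitInterval) × Set.Icc (-M) M) :=
    ⟨fun x => (F x, ⟨h x, abs_le.1 (h.norm_coe_le_norm x)⟩),
      hF.continuous.prodMk (h.continuous.subtype_mk _)⟩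
  obtain ⟨ν', hν', hνi'⟩ := daniell_pull Λ hpos hcont ι'
    (fun x y hxy => hF.injective (congrArg Prod.fst hxy))
  have hemb : MeasurableEmbedding ι := ι.continuous.measurableEmbedding hF.injective
  have e : ν = ν' := by
    have : ν.map ι = ν'.map ι := by
      apply ext_of_forall_integral_eq_of_IsFiniteMeasure
      intro f
      rw [hemb.integral_map, hemb.integral_map]
      have e1 := hνi f.toContinuousMap
      have e2 := hνi' (f.toContinuousMap.comp ⟨Prod.fst, continuous_fst⟩)
      exact e1.trans e2.symm
    rw [← hemb.comap_map ν, this, hemb.comap_map]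
  have e2 := hνi' ⟨fun p => (p.2 : ℝ), by fun_prop⟩
  rw [e]
  refine e2.trans ?_
  congr 1

theorem exists_subgrad {E : Type*} [AddCommGroup E] [Module ℝ E] (ψ : E → ℝ)
    (hc : ∀ f g : E, ∀ l : ℝ, 0 ≤ l → l ≤ 1 →
      ψ (l • f + (1 - l) • g) ≤ l * ψ f + (1 - l) * ψ g) (f : E) :
    ∃ L : E →ₗ[ℝ] ℝ, ∀ h, L h ≤ ψ (f + h) - ψ f := by
  let q : E → Set.Ioi (0:ℝ) → ℝ := fun h t => (ψ (f + (t:ℝ) • h) - ψ f) / t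
  let N : E → ℝ := fun h => ⨅ t, q h t
  have hbdd : ∀ h, BddBelow (Set.range (q h)) := by
    intro h
    refine ⟨ψ f - ψ (f - h), ?_⟩
    rintro _ ⟨⟨t, ht⟩, rfl⟩
    have ht : 0 < t := ht
    simp only [q]
    rw [le_div_iff₀ ht]
    have h1 := hc (f + t • h) (f - h) (1 / (1 + t)) (by positivity)
      (by rw [div_le_one (by positivity)]; linarith)
    have e : (1 / (1 + t)) • (f + t • h) + (1 - 1 / (1 + t)) • (f - h) = f := by
      have : (1 - 1 / (1 + t)) = t / (1 + t) := by field_simp; ring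
      rw [this]
      match_scalars
      · field_simp
      · field_simp; ring
    rw [e] at h1
    have e2 : 1 / (1 + t) * ψ (f + t • h) + (1 - 1 / (1 + t)) * ψ (f - h)
      = (ψ (f + t • h) + t * ψ (f - h)) / (1 + t) := by field_simp; ring
    rw [e2, le_div_iff₀ (by positivity)] at h1
    nlinarith
  have hNle : ∀ h (t : ℝ), 0 < t → N h ≤ (ψ (f + t • h) - ψ f) / t := fun h t ht =>
    ciInf_le (hbdd h) ⟨t, ht⟩
  have hadd : ∀ x y, N (x + y) ≤ N x + N y := by
    intro x y
    refine le_ciInf_add_ciInf ?_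
    rintro ⟨s, hs⟩ ⟨t, ht⟩
    have hs : 0 < s := hs
    have ht : 0 < t := ht
    refine (hNle (x + y) (s * t / (s + t)) (by positivity)).trans ?_
    simp only [q]
    have h1 := hc (f + s • x) (f + t • y) (t / (s + t)) (by positivity)
      (by rw [div_le_one (by positivity)]; linarith)
    have e : (t / (s + t)) • (f + s • x) + (1 - t / (s + t)) • (f + t • y)
        = f + (s * t / (s + t)) • (x + y) := by
      have : (1 - t / (s + t)) = s / (s + t) := by field_simp; ring
      rw [this]
      match_scalars
      · field_simp; ring
      · field_simp
      · field_simp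
    rw [e] at h1
    rw [div_le_iff₀ (by positivity)]
    have e2 : ((ψ (f + s • x) - ψ f) / s + (ψ (f + t • y) - ψ f) / t) * (s * t / (s + t))
       = t / (s + t) * ψ (f + s • x) + (1 - t / (s + t)) * ψ (f + t • y) - ψ f := by
      field_simp; ring
    rw [e2]
    linarith
  have hle : ∀ c : ℝ, 0 < c → ∀ x, c * N x ≤ N (c • x) := by
    intro c hcp x
    refine le_ciInf ?_
    rintro ⟨t, ht⟩
    have ht : 0 < t := ht
    have := hNle x (t * c) (by positivity)
    simp only [q, smul_smul]
    rw [le_div_iff₀ (by positivity)] at this ⊢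
    linarith
  have hhom : ∀ c : ℝ, 0 < c → ∀ x, N (c • x) = c * N x := by
    intro c hcp x
    refine le_antisymm ?_ (hle c hcp x)
    have := hle c⁻¹ (by positivity) (c • x)
    rw [smul_smul, inv_mul_cancel₀ hcp.ne', one_smul] at this
    rwa [inv_mul_le_iff₀ hcp] at this
  have hN0 : N 0 = 0 := by simp [N, q]
  obtain ⟨L, -, hL⟩ := exists_extension_of_le_sublinear (⟨⊥, 0⟩ : E →ₗ.[ℝ] ℝ) N hhom hadd (by
    rintro ⟨x, hx⟩
    have : x = 0 := by simpa using hx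
    subst this
    simp [hN0])
  exact ⟨L, fun h => by simpa using (hL h).trans (hNle h 1 one_pos)⟩

/-- The space `C_κ` as a submodule. -/
def CkSub {X : Type*} [MetricSpace X] (κ : X → ℝ) (hκpos : ∀ x, 0 < κ x) :
    Submodule ℝ (X → ℝ) where
  carrier := {f | MemCk κ f}
  zero_mem' := ⟨continuous_const, 0, fun x => by simp⟩
  add_mem' := by
    rintro f g ⟨hf, a, ha⟩ ⟨hg, b, hb⟩
    refine ⟨hf.add hg, a + b, fun x => ?_⟩
    have := ha x
    have := hb x
    have := mul_le_mul_of_nonneg_right (abs_add_le (f x) (g x)) (hκpos x).le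
    simp only [Pi.add_apply]
    linarith
  smul_mem' := by
    rintro c f ⟨hf, a, ha⟩
    refine ⟨hf.const_smul c, |c| * a, fun x => ?_⟩
    simp only [Pi.smul_apply, smul_eq_mul, abs_mul, mul_assoc]
    exact mul_le_mul_of_nonneg_left (ha x) (abs_nonneg c)

theorem memCk_div {X : Type*} [MetricSpace X] (κ : X → ℝ) (hκc : Continuous κ)
    (hκpos : ∀ x, 0 < κ x) (h : X → ℝ) (hc : Continuous h) (M : ℝ) (hM : ∀ x, |h x| ≤ M) :
    MemCk κ (fun x => h x / κ x) := by
  refine ⟨hc.div hκc (fun x => (hκpos x).ne'), M, fun x => ?_⟩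
  rw [abs_div, abs_of_pos (hκpos x), div_mul_cancel₀ _ (hκpos x).ne']
  exact hM x

/-- Transport of a functional on `C_κ` to bounded functions. -/
noncomputable def ckToBcf {X : Type*} [MetricSpace X] (κ : X → ℝ) (hκc : Continuous κ)
    (hκpos : ∀ x, 0 < κ x) (L : CkSub κ hκpos →ₗ[ℝ] ℝ) :
    BoundedContinuousFunction X ℝ →ₗ[ℝ] ℝ where
  toFun h := L ⟨fun x => h x / κ x, memCk_div κ hκc hκpos h h.continuous ‖h‖ h.norm_coe_le_norm⟩
  map_add' a b := by
    rw [← map_add]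
    congr 1
    ext x
    simp [add_div]
  map_smul' c a := by
    rw [← map_smul]
    congr 1
    ext x
    simp [mul_div_assoc]

theorem integrable_ck {X : Type*} [MetricSpace X] [MeasurableSpace X] [BorelSpace X]
    (κ : X → ℝ) (hκc : Continuous κ) (hκpos : ∀ x, 0 < κ x) (μ : Measure X)
    (hμ : (∫⁻ x, ENNReal.ofReal (κ x)⁻¹ ∂μ) ≠ ⊤) (f : X → ℝ) (hf : MemCk κ f) :
    Integrable f μ := by
  obtain ⟨hf, a, ha⟩ := hf
  have hi : Integrable (fun x => (κ x)⁻¹) μ := by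
    refine ⟨(hκc.measurable.inv).aestronglyMeasurable, ?_⟩
    rw [hasFiniteIntegral_iff_ofReal (ae_of_all _ fun x => (inv_pos.2 (hκpos x)).le)]
    exact hμ.lt_top
  refine (hi.const_mul a).mono' hf.measurable.aestronglyMeasurable (ae_of_all _ fun x => ?_)
  rw [Real.norm_eq_abs, ← div_eq_mul_inv, le_div_iff₀ (hκpos x)]
  exact ha x

theorem daniell_ck {X : Type*} [MetricSpace X] [CompleteSpace X]
    [TopologicalSpace.SeparableSpace X] [MeasurableSpace X] [BorelSpace X]
    (κ : X → ℝ) (hκc : Continuous κ) (hκpos : ∀ x, 0 < κ x)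
    (L : CkSub κ hκpos →ₗ[ℝ] ℝ)
    (hpos : ∀ f : CkSub κ hκpos, (∀ x, 0 ≤ f.1 x) → 0 ≤ L f)
    (hcont : ∀ fn : ℕ → CkSub κ hκpos, (∀ x, Antitone fun n => (fn n).1 x) →
      (∀ x, Tendsto (fun n => (fn n).1 x) atTop (𝓝 0)) →
      Tendsto (fun n => L (fn n)) atTop (𝓝 0)) :
    ∃ μ : Measure X, (∫⁻ x, ENNReal.ofReal (κ x)⁻¹ ∂μ) ≠ ⊤ ∧
      ∀ f : CkSub κ hκpos, ∫ x, f.1 x ∂μ = L f := by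
  have : SecondCountableTopology X := UniformSpace.secondCountable_of_separable X
  obtain ⟨ν, hν, hνi⟩ := daniell_bcf (ckToBcf κ hκc hκpos L)
    (fun f hf => hpos _ fun x => div_nonneg (hf x) (hκpos x).le)
    (fun fn hfn hfn0 => hcont _
      (fun x n m hnm => div_le_div_of_nonneg_right (hfn x hnm) (hκpos x).le)
      (fun x => by simpa using (hfn0 x).div_const (κ x)))
  have hm : Measurable (fun x => (κ x).toNNReal) := hκc.measurable.real_toNNReal
  refine ⟨ν.withDensity (fun x => ((κ x).toNNReal : ℝ≥0∞)), ?_, ?_⟩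
  · have hm2 : Measurable (fun x => ENNReal.ofReal (κ x)⁻¹) :=
      (hκc.measurable.inv : Measurable (fun x => (κ x)⁻¹)).ennreal_ofReal
    rw [lintegral_withDensity_eq_lintegral_mul _ hm.coe_nnreal_ennreal hm2]
    have : ∀ x, ((fun x => ((κ x).toNNReal : ℝ≥0∞)) * fun x => ENNReal.ofReal (κ x)⁻¹) x = 1 := by
      intro x
      simp only [Pi.mul_apply]
      change ENNReal.ofReal _ * _ = 1
      rw [← ENNReal.ofReal_mul (hκpos x).le, mul_inv_cancel₀ (hκpos x).ne', ENNReal.ofReal_one]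
    simp only [this, lintegral_one]
    exact measure_ne_top _ _
  · rintro ⟨f, hf⟩
    rw [integral_withDensity_eq_integral_smul hm]
    obtain ⟨hfc, a, ha⟩ := id hf
    let g : BoundedContinuousFunction X ℝ := BoundedContinuousFunction.ofNormedAddCommGroup
      (fun x => κ x * f x) (hκc.mul hfc) a (fun x => by
        rw [Real.norm_eq_abs, abs_mul, abs_of_pos (hκpos x), mul_comm]; exact ha x)
    have h1 := hνi g
    have h2 : ∀ x, (κ x).toNNReal • f x = g x := by
      intro x
      rw [NNReal.smul_def, Real.coe_toNNReal _ (hκpos x).le]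
      rfl
    simp only [h2]
    rw [h1]
    change L _ = L _
    congr 1
    ext x
    change κ x * f x / κ x = f x
    have := (hκpos x).ne'
    field_simp

theorem dualConj_le_iff {X : Type*} [MetricSpace X] [MeasurableSpace X]
    (κ : X → ℝ) (φ : (X → ℝ) → ℝ) (μ : Measure X) (c : ℝ) :
    dualConj κ φ μ ≤ (c : EReal) ↔ ∀ f, MemCk κ f → ∫ x, f x ∂μ - φ f ≤ c := by
  unfold dualConj
  rw [iSup_le_iff]
  constructor
  · intro h f hf
    exact_mod_cast h ⟨f, hf⟩
  · rintro h ⟨f, hf⟩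
    exact_mod_cast h f hf

theorem le_dualConj {X : Type*} [MetricSpace X] [MeasurableSpace X]
    (κ : X → ℝ) (φ : (X → ℝ) → ℝ) (μ : Measure X) (f : X → ℝ) (hf : MemCk κ f) :
    ((∫ x, f x ∂μ - φ f : ℝ) : EReal) ≤ dualConj κ φ μ := by
  unfold dualConj
  rw [EReal.coe_sub]
  exact le_iSup (fun f : {g : X → ℝ // MemCk κ g} =>
    (((∫ x, f.1 x ∂μ) : ℝ) : EReal) - ((φ f.1 : ℝ) : EReal)) ⟨f, hf⟩

theorem compact_levelset {X : Type*} [MetricSpace X] [CompleteSpace X]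
    [TopologicalSpace.SeparableSpace X] [MeasurableSpace X] [BorelSpace X]
    (κ : X → ℝ) (hκc : Continuous κ) (hκpos : ∀ x, 0 < κ x)
    (φ : (X → ℝ) → ℝ) (hzero : φ (fun _ => 0) = 0)
    (hca : ∀ (fn : ℕ → X → ℝ) (f : X → ℝ), (∀ n, MemCk κ (fn n)) → MemCk κ f →
      (∀ x, Antitone fun n => fn n x) → (∀ x, Tendsto (fun n => fn n x) atTop (𝓝 (f x))) →
      Tendsto (fun n => φ (fn n)) atTop (𝓝 (φ f))) (c : ℝ) :
    @IsCompact _ (weakTopo κ)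
        {μ : Measure X | (∫⁻ x, ENNReal.ofReal (κ x)⁻¹ ∂μ) ≠ ⊤ ∧ dualConj κ φ μ ≤ (c : EReal)} := by
  let _ : TopologicalSpace (Measure X) := weakTopo κ
  rw [isCompact_iff_ultrafilter_le_nhds']
  intro F hF
  have hsm : ∀ (f : CkSub κ hκpos), ∃ l : ℝ, Tendsto (fun μ : Measure X => ∫ x, f.1 x ∂μ) F (𝓝 l) := by
    intro f
    have hIcc : ∀ᶠ μ in (F : Filter (Measure X)),
        ∫ x, f.1 x ∂μ ∈ Set.Icc (-(φ (-f).1 + c)) (φ f.1 + c) := by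
      filter_upwards [hF] with μ hμ
      have h1 := (dualConj_le_iff κ φ μ c).1 hμ.2
      have h2 := h1 f.1 f.2
      have h3 := h1 (-f).1 (-f).2
      have h4 : ∫ x, (-f).1 x ∂μ = - ∫ x, f.1 x ∂μ := integral_neg _
      constructor <;> linarith
    obtain ⟨l, -, hl⟩ := isCompact_iff_ultrafilter_le_nhds'.1
      (isCompact_Icc (a := -(φ (-f).1 + c)) (b := φ f.1 + c))
      (F.map (fun μ : Measure X => ∫ x, f.1 x ∂μ)) hIcc
    exact ⟨l, hl⟩
  choose l hl using hsm
  have hint : ∀ᶠ μ in (F : Filter (Measure X)), ∀ f : CkSub κ hκpos, Integrable f.1 μ := by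
    filter_upwards [hF] with μ hμ f
    exact integrable_ck κ hκc hκpos μ hμ.1 f.1 f.2
  let L : CkSub κ hκpos →ₗ[ℝ] ℝ :=
    { toFun := l
      map_add' := fun f g => by
        refine tendsto_nhds_unique (hl (f + g)) (((hl f).add (hl g)).congr' ?_)
        filter_upwards [hint] with μ hμ
        exact (integral_add (hμ f) (hμ g)).symm
      map_smul' := fun a f => by
        refine tendsto_nhds_unique (hl (a • f)) (((hl f).const_mul a).congr' ?_)
        filter_upwards [hint] with μ hμ
        exact (integral_const_mul a f.1).symm }
  have hLφ : ∀ f : CkSub κ hκpos, L f ≤ φ f.1 + c := by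
    intro f
    refine le_of_tendsto (hl f) ?_
    filter_upwards [hF] with μ hμ
    have h1 := (dualConj_le_iff κ φ μ c).1 hμ.2 f.1 f.2
    linarith
  have hLpos : ∀ f : CkSub κ hκpos, (∀ x, 0 ≤ f.1 x) → 0 ≤ L f := fun f hf =>
    ge_of_tendsto' (hl f) fun μ => integral_nonneg hf
  obtain ⟨μ, hμ, hμi⟩ := daniell_ck κ hκc hκpos L hLpos (by
    intro fn hfn hfn0
    have hn : ∀ n x, 0 ≤ (fn n).1 x := fun n x => (hfn x).le_of_tendsto (hfn0 x) n
    rw [Metric.tendsto_atTop]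
    intro ε hε
    obtain ⟨k, hk⟩ := exists_nat_gt (max 0 ((1 + c) / ε))
    have hk0 : (0:ℝ) < k := (le_max_left _ _).trans_lt hk
    have hk1 : (1 + c) / ε < k := (le_max_right _ _).trans_lt hk
    have ht := hca (fun n => ((k:ℝ) • fn n).1) (fun _ => 0) (fun n => ((k:ℝ) • fn n).2)
      (CkSub κ hκpos).zero_mem
      (fun x n m hnm => mul_le_mul_of_nonneg_left (hfn x hnm) hk0.le)
      (fun x => by simpa using (hfn0 x).const_mul (k:ℝ))
    rw [hzero] at ht
    obtain ⟨n0, hn0⟩ := eventually_atTop.1 (ht.eventually (gt_mem_nhds one_pos))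
    refine ⟨n0, fun n hnn => ?_⟩
    have h1 := hn0 n hnn
    have h2 := hLφ ((k:ℝ) • fn n)
    rw [map_smul, smul_eq_mul] at h2
    rw [Real.dist_eq, sub_zero, abs_of_nonneg (hLpos _ (hn n))]
    rw [div_lt_iff₀ hε] at hk1
    have : k * L (fn n) < k * ε := by linarith
    exact lt_of_mul_lt_mul_left this hk0.le)
  refine ⟨μ, ⟨hμ, ?_⟩, ?_⟩
  · rw [dualConj_le_iff]
    intro f hf
    have h1 := hLφ ⟨f, hf⟩
    have h2 := hμi ⟨f, hf⟩
    simp only at h2 h1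
    linarith
  · have : 𝓝 μ = comap (fun μ => fun f : {g : X → ℝ // MemCk κ g} => ∫ x, f.1 x ∂μ) (𝓝 (fun f => ∫ x, f.1 x ∂μ)) :=
      nhds_induced _ _
    rw [this, ← tendsto_iff_comap, tendsto_pi_nhds]
    intro f
    have h1 := hl ⟨f.1, f.2⟩
    have h2 : ∫ x, f.1 x ∂μ = l ⟨f.1, f.2⟩ := hμi ⟨f.1, f.2⟩
    rw [h2]
    exact h1

/-- dual representation of convex monotone functionals on `C_κ`
which are continuous from above. -/
theorem stmt4
    {X : Type*} [MetricSpace X] [CompleteSpace X] [TopologicalSpace.SeparableSpace X]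
    [MeasurableSpace X] [BorelSpace X]
    (κ : X → ℝ) (hκc : Continuous κ) (hκpos : ∀ x, 0 < κ x) (hκbd : ∃ C, ∀ x, κ x ≤ C)
    (φ : (X → ℝ) → ℝ)
    (hmono : ∀ f g, MemCk κ f → MemCk κ g → (∀ x, f x ≤ g x) → φ f ≤ φ g)
    (hconv : ∀ f g, MemCk κ f → MemCk κ g → ∀ lam : ℝ, 0 ≤ lam → lam ≤ 1 →
        φ (fun y => lam * f y + (1 - lam) * g y) ≤ lam * φ f + (1 - lam) * φ g)
    (hzero : φ (fun _ => 0) = 0)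
    (hca : ∀ (fn : ℕ → X → ℝ) (f : X → ℝ), (∀ n, MemCk κ (fn n)) → MemCk κ f →
      (∀ x, Antitone fun n => fn n x) → (∀ x, Tendsto (fun n => fn n x) atTop (𝓝 (f x))) →
      Tendsto (fun n => φ (fn n)) atTop (𝓝 (φ f)))
    (r : ℝ) (hr : 0 ≤ r) :
    (∀ μ ν : Measure X,
        μ ∈ {μ : Measure X | (∫⁻ x, ENNReal.ofReal (κ x)⁻¹ ∂μ) ≠ ⊤ ∧
              dualConj κ φ μ ≤ ((φ (fun x => 2 * r / κ x) - 2 * φ (fun x => -r / κ x) : ℝ) : EReal)} →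
        ν ∈ {μ : Measure X | (∫⁻ x, ENNReal.ofReal (κ x)⁻¹ ∂μ) ≠ ⊤ ∧
              dualConj κ φ μ ≤ ((φ (fun x => 2 * r / κ x) - 2 * φ (fun x => -r / κ x) : ℝ) : EReal)} →
        ∀ a : ℝ≥0, a ≤ 1 →
          (a • μ + (1 - a) • ν) ∈ {μ : Measure X | (∫⁻ x, ENNReal.ofReal (κ x)⁻¹ ∂μ) ≠ ⊤ ∧
            dualConj κ φ μ ≤ ((φ (fun x => 2 * r / κ x) - 2 * φ (fun x => -r / κ x) : ℝ) : EReal)}) ∧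
    (@IsCompact _ (weakTopo κ)
        {μ : Measure X | (∫⁻ x, ENNReal.ofReal (κ x)⁻¹ ∂μ) ≠ ⊤ ∧
          dualConj κ φ μ ≤ ((φ (fun x => 2 * r / κ x) - 2 * φ (fun x => -r / κ x) : ℝ) : EReal)}) ∧
    (∀ f, MemCk κ f → CkBound κ r f →
      (∀ μ : Measure X, (∫⁻ x, ENNReal.ofReal (κ x)⁻¹ ∂μ) ≠ ⊤ →
        dualConj κ φ μ ≤ ((φ (fun x => 2 * r / κ x) - 2 * φ (fun x => -r / κ x) : ℝ) : EReal) →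
        ((∫ x, f x ∂μ : ℝ) : EReal) - dualConj κ φ μ ≤ ((φ f : ℝ) : EReal)) ∧
      (∃ μ : Measure X, (∫⁻ x, ENNReal.ofReal (κ x)⁻¹ ∂μ) ≠ ⊤ ∧
        dualConj κ φ μ ≤ ((φ (fun x => 2 * r / κ x) - 2 * φ (fun x => -r / κ x) : ℝ) : EReal) ∧
        ((φ f : ℝ) : EReal) = ((∫ x, f x ∂μ : ℝ) : EReal) - dualConj κ φ μ)) := by
  have hmul : ∀ c : ℝ, MemCk κ (fun x => c / κ x) := fun c =>
    memCk_div κ hκc hκpos (fun _ => c) continuous_const |c| (fun _ => le_rfl)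
  refine ⟨?_, compact_levelset κ hκc hκpos φ hzero hca _, ?_⟩
  · rintro μ ν ⟨hμ, hμd⟩ ⟨hν, hνd⟩ a ha
    rw [dualConj_le_iff] at hμd hνd
    refine ⟨?_, ?_⟩
    · rw [lintegral_add_measure, lintegral_smul_measure, lintegral_smul_measure]
      exact ENNReal.add_ne_top.2 ⟨ENNReal.mul_ne_top ENNReal.coe_ne_top hμ,
        ENNReal.mul_ne_top ENNReal.coe_ne_top hν⟩
    · rw [dualConj_le_iff]
      intro f hf
      have i1 := integrable_ck κ hκc hκpos μ hμ f hf
      have i2 := integrable_ck κ hκc hκpos ν hν f hf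
      rw [integral_add_measure (i1.smul_measure_nnreal) (i2.smul_measure_nnreal),
        integral_smul_nnreal_measure, integral_smul_nnreal_measure, NNReal.smul_def,
        NNReal.smul_def, NNReal.coe_sub ha]
      have h1 := hμd f hf
      have h2 := hνd f hf
      have ha1 : (a:ℝ) ≤ 1 := by exact_mod_cast ha
      have ha0 : (0:ℝ) ≤ a := a.2
      simp only [smul_eq_mul, NNReal.coe_one]
      nlinarith
  · intro f hf hfr
    constructor
    · intro μ hμ hμd
      have h1 := le_dualConj κ φ μ f hf
      have hne : dualConj κ φ μ ≠ ⊤ := fun h => by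
        rw [h] at hμd; exact absurd hμd (not_le.2 (EReal.coe_lt_top _))
      have hne' : dualConj κ φ μ ≠ ⊥ := fun h => by
        rw [h] at h1; exact absurd h1 (not_le.2 (EReal.bot_lt_coe _))
      lift dualConj κ φ μ to ℝ using ⟨hne, hne'⟩ with d
      norm_cast at h1 ⊢
      linarith
    · obtain ⟨L, hL⟩ := exists_subgrad (E := CkSub κ hκpos) (fun g => φ g.1)
        (fun f g lam h0 h1 => hconv f.1 g.1 f.2 g.2 lam h0 h1) ⟨f, hf⟩
      have hLpos : ∀ g : CkSub κ hκpos, (∀ x, 0 ≤ g.1 x) → 0 ≤ L g := by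
        intro g hg
        have h1 := hL (-g)
        rw [map_neg] at h1
        have h2 := hmono ((⟨f, hf⟩ + -g : CkSub κ hκpos)).1 f (Subtype.prop _) hf (fun x => by
          have : ((⟨f, hf⟩ + -g : CkSub κ hκpos)).1 x = f x + - g.1 x := rfl
          rw [this]
          linarith [hg x])
        linarith
      obtain ⟨μ, hμ, hμi⟩ := daniell_ck κ hκc hκpos L hLpos (by
        intro fn hfn hfn0
        have hn : ∀ n x, 0 ≤ (fn n).1 x := fun n x => (hfn x).le_of_tendsto (hfn0 x) n
        have ht := hca (fun n => (⟨f, hf⟩ + fn n : CkSub κ hκpos).1) f (fun n => Subtype.prop _) hf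
          (fun x n m hnm => add_le_add_right (hfn x hnm) (f x))
          (fun x => by simpa using (hfn0 x).const_add (f x))
        refine tendsto_of_tendsto_of_tendsto_of_le_of_le tendsto_const_nhds
          (by simpa using ht.sub_const (φ f)) (fun n => hLpos _ (hn n)) (fun n => hL (fn n)))
      have hsub : ∀ g, MemCk κ g → ∫ x, g x ∂μ - φ g ≤ ∫ x, f x ∂μ - φ f := by
        intro g hg
        have h1 := hL (⟨g, hg⟩ - ⟨f, hf⟩)
        rw [map_sub, ← hμi, ← hμi, add_sub_cancel] at h1
        simp only at h1
        linarith
      have hd : dualConj κ φ μ = ((∫ x, f x ∂μ - φ f : ℝ) : EReal) :=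
        le_antisymm ((dualConj_le_iff _ _ _ _).2 hsub) (le_dualConj κ φ μ f hf)
      refine ⟨μ, hμ, ?_, ?_⟩
      · rw [dualConj_le_iff]
        intro g hg
        refine (hsub g hg).trans ?_
        have hle : ∀ x, |f x| ≤ r / κ x := fun x => by
          rw [le_div_iff₀ (hκpos x)]; exact hfr x
        have h1 := hsub _ (hmul (2 * r))
        have h2 : φ (fun x => -r / κ x) ≤ φ f := hmono _ _ (hmul (-r)) hf (fun x => by
          have := (abs_le.1 (hle x)).1
          rw [neg_div]; exact this)
        have h3 : 2 * ∫ x, f x ∂μ ≤ ∫ x, 2 * r / κ x ∂μ := by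
          rw [← integral_const_mul]
          refine integral_mono ((integrable_ck κ hκc hκpos μ hμ f hf).const_mul 2)
            (integrable_ck κ hκc hκpos μ hμ _ (hmul _)) (fun x => ?_)
          have := (abs_le.1 (hle x)).2
          simp only
          rw [mul_div_assoc]
          linarith
        linarith
      · rw [hd]
        norm_cast
        ring
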